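/- arXiv:1009.3824 — 4 statements merged into one kernel-verified Lean document; each statement's English description precedes it below -/
import Mathlib

section
/- Let μ be a finite Borel measure on ℝ^N and let ℱ be a family of probability density functions on ℝ^N that is equicontinuous and uniformly bounded. Define Ψ = {P_p : p ∈ ℱ and P_p ≤ μ}, where P_p is the probability measure with density p (P_p(A) = ∫_A p(x) dx) and P_p ≤ μ means P_p(A) ≤ μ(A) for all Borel A. Then Ψ is precompact under total variation: every sequence in Ψ has a subsequence converging in total variation to a probability measure on ℝ^N. -/
open MeasureTheory Filter Topology

/-- The total variation distance `‖μ − ν‖_TV = 2 sup_B |μ(B) − ν(B)|`,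
the supremum over measurable sets `B`. -/
noncomputable def tvDist {α : Type*} [MeasurableSpace α] (μ ν : Measure α) : ℝ :=
  2 * ⨆ B : {B : Set α // MeasurableSet B}, |(μ B.1).toReal - (ν B.1).toReal|

/-- The probability measure `P_p` induced by a probability density `p` on `ℝ^N`. -/
noncomputable def densMeasure {N : ℕ} (p : (Fin N → ℝ) → ℝ) : Measure (Fin N → ℝ) :=
  volume.withDensity fun x => ENNReal.ofReal (p x)

/-- A pointwise bounded equicontinuous sequence of real functions on a separable space has a
subsequence converging pointwise. -/
theorem exists_subseq_tendsto_pointwise_of_equicontinuous {X : Type*} [TopologicalSpace X]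
    [TopologicalSpace.SeparableSpace X] {F : ℕ → X → ℝ} (hF : Equicontinuous F)
    {a b : X → ℝ} (hab : ∀ n x, F n x ∈ Set.Icc (a x) (b x)) :
    ∃ φ : ℕ → ℕ, StrictMono φ ∧ ∃ f : X → ℝ,
      ∀ x, Tendsto (fun n => F (φ n) x) atTop (𝓝 (f x)) := by
  obtain ⟨D, hDc, hDd⟩ := TopologicalSpace.exists_countable_dense X
  have : Countable D := hDc.to_subtype
  have hK : IsCompact (Set.univ.pi fun d : D => Set.Icc (a d) (b d)) :=
    isCompact_univ_pi fun _ => isCompact_Icc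
  obtain ⟨g, -, φ, hφ, hg⟩ := hK.tendsto_subseq (x := fun n (d : D) => F n d)
    fun n d _ => hab n d
  rw [tendsto_pi_nhds] at hg
  have hconv : ∀ x, ∃ y, Tendsto (fun n => F (φ n) x) atTop (𝓝 y) := by
    intro x
    refine cauchySeq_tendsto_of_complete (Metric.cauchySeq_iff'.2 fun ε hε => ?_)
    have hx := Metric.equicontinuousAt_iff_right.1 (hF x) (ε / 4) (by positivity)
    obtain ⟨d, hd, hdD⟩ := mem_closure_iff_nhds.1 (hDd x) _ hx
    obtain ⟨M, hM⟩ := Metric.cauchySeq_iff'.1 (hg ⟨d, hdD⟩).cauchySeq (ε / 4) (by positivity)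
    refine ⟨M, fun n hn => ?_⟩
    have h₁ := hd (φ n)
    have h₂ := hd (φ M)
    have h₃ := hM n hn
    simp only [Function.comp_apply] at h₃
    rw [Real.dist_eq, abs_lt] at *
    constructor <;> linarith
  choose f hf using hconv
  exact ⟨φ, hφ, f, hf⟩

/-- A density of a measure dominated by `μ` is dominated by the Radon–Nikodym derivative of `μ`. -/
theorem ae_le_rnDeriv_of_withDensity_le {α : Type*} [MeasurableSpace α] {μ ν : Measure α}
    [SigmaFinite ν] [μ.HaveLebesgueDecomposition ν] {f : α → ENNReal} (hf : Measurable f)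
    (h : ν.withDensity f ≤ μ) : f ≤ᵐ[ν] μ.rnDeriv ν := by
  refine ae_le_of_forall_setLIntegral_le_of_sigmaFinite hf fun s hs _ => ?_
  obtain ⟨t, ht, hsing, hνt⟩ := μ.mutuallySingular_singularPart ν
  have hae : (s ∩ t : Set α) =ᵐ[ν] s := by
    refine inter_ae_eq_left_of_ae_eq_univ ?_
    rwa [ae_eq_univ]
  rw [← setLIntegral_congr hae, ← setLIntegral_congr hae, ← withDensity_apply _ (hs.inter ht),
    ← withDensity_apply _ (hs.inter ht)]
  calc ν.withDensity f (s ∩ t) ≤ μ (s ∩ t) := h _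
    _ = ν.withDensity (μ.rnDeriv ν) (s ∩ t) := by
      conv_lhs => rw [μ.haveLebesgueDecomposition_add ν]
      rw [Measure.add_apply, measure_mono_null Set.inter_subset_right hsing, zero_add]

theorem toReal_densMeasure_apply {N : ℕ} {p : (Fin N → ℝ) → ℝ} (hp : Measurable p)
    (hp0 : ∀ x, 0 ≤ p x) {B : Set (Fin N → ℝ)} (hB : MeasurableSet B) :
    (densMeasure p B).toReal = ∫ x in B, p x := by
  rw [densMeasure, withDensity_apply _ hB,
    integral_eq_lintegral_of_nonneg_ae (Eventually.of_forall hp0) hp.aestronglyMeasurable]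

theorem isProbabilityMeasure_densMeasure {N : ℕ} {p : (Fin N → ℝ) → ℝ}
    (hp0 : ∀ x, 0 ≤ p x) (hp1 : ∫ x, p x = 1) : IsProbabilityMeasure (densMeasure p) := by
  have hint : Integrable p := by
    by_contra h
    simp [integral_undef h] at hp1
  constructor
  rw [densMeasure, withDensity_apply _ MeasurableSet.univ, setLIntegral_univ,
    ← ofReal_integral_eq_lintegral_ofReal hint (Eventually.of_forall hp0), hp1, ENNReal.ofReal_one]

theorem tvDist_nonneg {α : Type*} [MeasurableSpace α] (μ ν : Measure α) : 0 ≤ tvDist μ ν :=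
  mul_nonneg zero_le_two (Real.iSup_nonneg fun _ => abs_nonneg _)

theorem tvDist_densMeasure_le {N : ℕ} {p q : (Fin N → ℝ) → ℝ} (hp : Measurable p)
    (hp0 : ∀ x, 0 ≤ p x) (hpi : Integrable p) (hq : Measurable q) (hq0 : ∀ x, 0 ≤ q x)
    (hqi : Integrable q) :
    tvDist (densMeasure p) (densMeasure q) ≤ 2 * ∫ x, |p x - q x| := by
  refine mul_le_mul_of_nonneg_left (Real.iSup_le (fun B => ?_) ?_) zero_le_two
  · rw [toReal_densMeasure_apply hp hp0 B.2, toReal_densMeasure_apply hq hq0 B.2,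
      ← integral_sub hpi.integrableOn hqi.integrableOn]
    exact abs_integral_le_integral_abs.trans
      (setIntegral_le_integral (hpi.sub hqi).abs (Eventually.of_forall fun _ => abs_nonneg _))
  · exact integral_nonneg fun _ => abs_nonneg _

/-- Lemma 4.3: if `ℱ` is an equicontinuous, uniformly bounded family of probability
densities on `ℝ^N` and `μ` is a finite Borel measure, then
`Ψ = {P_p : p ∈ ℱ, P_p ≤ μ}` is precompact under total variation: every sequence in `Ψ`
has a subsequence converging in total variation to a probability measure. -/
theorem stmt9 (N : ℕ) (μ : Measure (Fin N → ℝ)) [IsFiniteMeasure μ]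
    (ℱ : Set ((Fin N → ℝ) → ℝ))
    (h_dens : ∀ p ∈ ℱ, Measurable p ∧ (∀ x, 0 ≤ p x) ∧ ∫ x, p x = 1)
    (h_equi : Equicontinuous fun p : ℱ => (p : (Fin N → ℝ) → ℝ))
    (h_bdd : ∃ C : ℝ, ∀ p ∈ ℱ, ∀ x, p x ≤ C)
    (ps : ℕ → (Fin N → ℝ) → ℝ) (hps : ∀ j, ps j ∈ ℱ)
    (hmaj : ∀ j, ∀ A : Set (Fin N → ℝ), MeasurableSet A → densMeasure (ps j) A ≤ μ A) :
    ∃ φ : ℕ → ℕ, StrictMono φ ∧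
      ∃ ρ : Measure (Fin N → ℝ), IsProbabilityMeasure ρ ∧
        Tendsto (fun i => tvDist (densMeasure (ps (φ i))) ρ) atTop (𝓝 0) := by
  obtain ⟨C, hC⟩ := h_bdd
  have hm n : Measurable (ps n) := (h_dens _ (hps n)).1
  have h0 n : ∀ x, 0 ≤ ps n x := (h_dens _ (hps n)).2.1
  have h1 n : ∫ x, ps n x = 1 := (h_dens _ (hps n)).2.2
  have hequi : Equicontinuous ps := h_equi.comp fun n => ⟨ps n, hps n⟩
  obtain ⟨φ, hφ, f, hf⟩ := exists_subseq_tendsto_pointwise_of_equicontinuous hequi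
    (a := fun _ => 0) (b := fun _ => C) fun n x => ⟨h0 n x, hC _ (hps n) x⟩
  have hfm : Measurable f :=
    measurable_of_tendsto_metrizable (fun n => hm (φ n)) (tendsto_pi_nhds.2 hf)
  have hf0 x : 0 ≤ f x := ge_of_tendsto' (hf x) fun n => h0 _ x
  have hgi : Integrable fun x => (μ.rnDeriv volume x).toReal := Measure.integrable_toReal_rnDeriv
  have hbound n : ∀ᵐ x, ‖ps n x‖ ≤ (μ.rnDeriv volume x).toReal := by
    filter_upwards [ae_le_rnDeriv_of_withDensity_le (hm n).ennreal_ofReal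
      (Measure.le_iff.2 (hmaj n)), μ.rnDeriv_lt_top volume] with x hx hx'
    rw [Real.norm_of_nonneg (h0 n x)]
    exact (ENNReal.ofReal_le_iff_le_toReal hx'.ne).1 hx
  have hpi n : Integrable (ps n) := hgi.mono' (hm n).aestronglyMeasurable (hbound n)
  have hfi : Integrable f := by
    refine hgi.mono' hfm.aestronglyMeasurable ?_
    filter_upwards [ae_all_iff.2 hbound] with x hx
    exact le_of_tendsto' (hf x).norm fun n => hx _
  have hf1 : ∫ x, f x = 1 := by
    refine tendsto_nhds_unique (tendsto_integral_of_dominated_convergence _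
      (fun n => (hm (φ n)).aestronglyMeasurable) hgi (fun n => hbound (φ n))
      (Eventually.of_forall hf)) ?_
    simp only [h1, tendsto_const_nhds]
  refine ⟨φ, hφ, densMeasure f, isProbabilityMeasure_densMeasure hf0 hf1, ?_⟩
  have hL1 : Tendsto (fun n => ∫ x, |ps (φ n) x - f x|) atTop (𝓝 0) := by
    rw [← integral_zero (Fin N → ℝ) ℝ]
    refine tendsto_integral_of_dominated_convergence
      (fun x => (μ.rnDeriv volume x).toReal + ‖f x‖)
      (fun n => ((hpi (φ n)).sub hfi).abs.aestronglyMeasurable) (hgi.add hfi.norm)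
      (fun n => ?_) (Eventually.of_forall fun x => ?_)
    · filter_upwards [hbound (φ n)] with x hx
      rw [Real.norm_eq_abs, abs_abs, ← Real.norm_eq_abs]
      exact (norm_sub_le _ _).trans (by gcongr)
    · simpa using ((hf x).sub_const (f x)).abs
  refine squeeze_zero (fun _ => tvDist_nonneg _ _) (fun i => tvDist_densMeasure_le (hm _) (h0 _)
    (hpi _) hfm hf0 hfi) ?_
  simpa using hL1.const_mul 2
end

section
/- Let P be a probability measure on 𝕏 and let 𝒬 be a set of observation channels that is compact under total variation at input P (every sequence in 𝒬 has a subsequence {Q_{n_k}} and a channel Q ∈ 𝒬 such that ‖PQ_{n_k} − PQ‖_TV → 0). Suppose the cost function c : 𝕏 × 𝕌 → ℝ is nonnegative, Borel measurable, and bounded. Then there exist both a best and a worst channel in 𝒬: channels attaining inf_{Q ∈ 𝒬} J(P,Q) and sup_{Q ∈ 𝒬} J(P,Q) respectively. -/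
open MeasureTheory ProbabilityTheory Filter Topology

/-- The optimal single-stage cost `J(P,Q) = inf_γ ∫ c(x,γ(y)) PQ(dx,dy)`, the infimum
over all Borel measurable policies `γ : 𝕐 → 𝕌`. -/
noncomputable def optCost {n m k : ℕ} (P : Measure (Fin n → ℝ)) (U : Set (Fin k → ℝ))
    (c : (Fin n → ℝ) → (Fin k → ℝ) → ℝ) (Q : Kernel (Fin n → ℝ) (Fin m → ℝ)) : ℝ :=
  sInf {r : ℝ | ∃ γ : (Fin m → ℝ) → (Fin k → ℝ), Measurable γ ∧ (∀ y, γ y ∈ U) ∧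
    r = ∫ z, c z.1 (γ z.2) ∂(P ⊗ₘ Q)}

lemma abs_measure_sub_le_tvDist {α : Type*} [MeasurableSpace α] (μ ν : Measure α)
    [IsProbabilityMeasure μ] [IsProbabilityMeasure ν] {B : Set α} (hB : MeasurableSet B) :
    |μ.real B - ν.real B| ≤ tvDist μ ν / 2 := by
  have hbdd : BddAbove (Set.range fun B : {B : Set α // MeasurableSet B} =>
      |(μ B.1).toReal - (ν B.1).toReal|) := by
    refine ⟨1, ?_⟩
    rintro _ ⟨B, rfl⟩
    have h1 : μ.real B.1 ≤ 1 := measureReal_le_one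
    have h2 : ν.real B.1 ≤ 1 := measureReal_le_one
    have h3 : 0 ≤ μ.real B.1 := measureReal_nonneg
    have h4 : 0 ≤ ν.real B.1 := measureReal_nonneg
    exact abs_sub_le_iff.2 ⟨by simp only [← measureReal_def]; linarith,
      by simp only [← measureReal_def]; linarith⟩
  have h := le_ciSup hbdd ⟨B, hB⟩
  unfold tvDist
  rw [mul_div_cancel_left₀ _ two_ne_zero]
  exact h

lemma abs_integral_sub_le_mul_tvDist {α : Type*} [MeasurableSpace α] (μ ν : Measure α)
    [IsProbabilityMeasure μ] [IsProbabilityMeasure ν] {f : α → ℝ} (hf : Measurable f)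
    {C : ℝ} (hC : 0 ≤ C) (hf0 : ∀ a, 0 ≤ f a) (hfC : ∀ a, f a ≤ C) :
    |∫ a, f a ∂μ - ∫ a, f a ∂ν| ≤ C * (tvDist μ ν / 2) := by
  have hint (ρ : Measure α) [IsProbabilityMeasure ρ] : Integrable f ρ :=
    Integrable.of_bound hf.aestronglyMeasurable C
      (.of_forall fun a => by rw [Real.norm_eq_abs, abs_of_nonneg (hf0 a)]; exact hfC a)
  have hlevel (ρ : Measure α) [IsProbabilityMeasure ρ] :
      IntegrableOn (fun t => ρ.real {a | t ≤ f a}) (Set.Ioc 0 C) := by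
    have hanti : Antitone fun t => ρ.real {a | t ≤ f a} := fun s t hst =>
      measureReal_mono fun a (ha : t ≤ f a) => hst.trans ha
    exact Integrable.of_bound hanti.measurable.aestronglyMeasurable 1
      (.of_forall fun t => by
        rw [Real.norm_eq_abs, abs_of_nonneg measureReal_nonneg]; exact measureReal_le_one)
  rw [(hint μ).integral_eq_integral_Ioc_meas_le (.of_forall hf0) (.of_forall hfC),
    (hint ν).integral_eq_integral_Ioc_meas_le (.of_forall hf0) (.of_forall hfC),
    ← integral_sub (hlevel μ) (hlevel ν), ← Real.norm_eq_abs]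
  refine (norm_setIntegral_le_of_norm_le_const (C := tvDist μ ν / 2) (by simp)
    fun t _ => ?_).trans_eq ?_
  · exact abs_measure_sub_le_tvDist μ ν (measurableSet_le measurable_const hf)
  · simp [hC, mul_comm]

lemma tvDist_comm {α : Type*} [MeasurableSpace α] (μ ν : Measure α) :
    tvDist μ ν = tvDist ν μ := by
  simp only [tvDist, abs_sub_comm]

section

variable {n m k : ℕ} {U : Set (Fin k → ℝ)} {c : (Fin n → ℝ) → (Fin k → ℝ) → ℝ}
  {P : Measure (Fin n → ℝ)}

lemma optCost_nonneg (hc0 : ∀ x u, 0 ≤ c x u) (Q : Kernel (Fin n → ℝ) (Fin m → ℝ)) :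
    0 ≤ optCost P U c Q := by
  refine Real.sInf_nonneg ?_
  rintro _ ⟨γ, -, -, rfl⟩
  exact integral_nonneg fun z => hc0 _ _

lemma optCost_le_integral (hc0 : ∀ x u, 0 ≤ c x u) (Q : Kernel (Fin n → ℝ) (Fin m → ℝ))
    {γ : (Fin m → ℝ) → (Fin k → ℝ)} (hγ : Measurable γ) (hγU : ∀ y, γ y ∈ U) :
    optCost P U c Q ≤ ∫ z, c z.1 (γ z.2) ∂(P ⊗ₘ Q) := by
  refine csInf_le ⟨0, ?_⟩ ⟨γ, hγ, hγU, rfl⟩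
  rintro _ ⟨γ, -, -, rfl⟩
  exact integral_nonneg fun z => hc0 _ _

lemma optCost_of_isEmpty (hU : U = ∅) (Q : Kernel (Fin n → ℝ) (Fin m → ℝ)) :
    optCost P U c Q = 0 := by
  simp [optCost, hU]

lemma optCost_le_add_mul_tvDist [IsProbabilityMeasure P] (hc0 : ∀ x u, 0 ≤ c x u)
    (hc : Measurable fun p : (Fin n → ℝ) × (Fin k → ℝ) => c p.1 p.2)
    {C : ℝ} (hC : ∀ x u, c x u ≤ C) (Q R : Kernel (Fin n → ℝ) (Fin m → ℝ))
    [IsMarkovKernel Q] [IsMarkovKernel R] (hU : U.Nonempty) :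
    optCost P U c Q ≤ optCost P U c R + C * (tvDist (P ⊗ₘ Q) (P ⊗ₘ R) / 2) := by
  obtain ⟨u, hu⟩ := hU
  rw [← sub_le_iff_le_add]
  refine le_csInf ⟨_, fun _ => u, measurable_const, fun _ => hu, rfl⟩ ?_
  rintro _ ⟨γ, hγ, hγU, rfl⟩
  have h1 := optCost_le_integral (P := P) hc0 Q hγ hγU
  have h2 := (abs_le.1 <| abs_integral_sub_le_mul_tvDist (P ⊗ₘ Q) (P ⊗ₘ R)
    (f := fun z => c z.1 (γ z.2))
    (hc.comp (measurable_fst.prodMk (hγ.comp measurable_snd)))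
    ((hc0 0 0).trans (hC 0 0)) (fun _ => hc0 _ _) fun _ => hC _ _).2
  linarith

lemma abs_optCost_sub_le_mul_tvDist [IsProbabilityMeasure P] (hc0 : ∀ x u, 0 ≤ c x u)
    (hc : Measurable fun p : (Fin n → ℝ) × (Fin k → ℝ) => c p.1 p.2)
    {C : ℝ} (hC : ∀ x u, c x u ≤ C) (Q R : Kernel (Fin n → ℝ) (Fin m → ℝ))
    [IsMarkovKernel Q] [IsMarkovKernel R] (hU : U.Nonempty) :
    |optCost P U c Q - optCost P U c R| ≤ C * (tvDist (P ⊗ₘ Q) (P ⊗ₘ R) / 2) := by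
  have h1 := optCost_le_add_mul_tvDist (P := P) hc0 hc hC Q R hU
  have h2 := optCost_le_add_mul_tvDist (P := P) hc0 hc hC R Q hU
  rw [tvDist_comm] at h2
  exact abs_sub_le_iff.2 ⟨by linarith, by linarith⟩

lemma optCost_le [IsProbabilityMeasure P] (hc0 : ∀ x u, 0 ≤ c x u)
    {C : ℝ} (hC : ∀ x u, c x u ≤ C) (Q : Kernel (Fin n → ℝ) (Fin m → ℝ))
    [IsMarkovKernel Q] (hU : U.Nonempty) : optCost P U c Q ≤ C := by
  obtain ⟨u, hu⟩ := hU
  refine (optCost_le_integral hc0 Q measurable_const fun _ => hu).trans ?_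
  refine (integral_mono_of_nonneg (.of_forall fun _ => hc0 _ _) (integrable_const C)
    (.of_forall fun _ => hC _ _)).trans_eq ?_
  simp

end

lemma exists_forall_le_of_subseq_tendsto {ι : Type*} [Nonempty ι] {J : ι → ℝ}
    (hbdd : BddBelow (Set.range J))
    (hJ : ∀ s : ℕ → ι, ∃ φ : ℕ → ℕ, StrictMono φ ∧ ∃ i0 : ι,
      Tendsto (fun j => J (s (φ j))) atTop (𝓝 (J i0))) :
    ∃ i0, ∀ i, J i0 ≤ J i := by
  obtain ⟨v, -, hv, hmem⟩ := exists_seq_tendsto_sInf (Set.range_nonempty J) hbdd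
  choose s hs using hmem
  obtain ⟨φ, hφ, i0, hi0⟩ := hJ s
  refine ⟨i0, fun i => ?_⟩
  have h : J i0 = sInf (Set.range J) := by
    refine tendsto_nhds_unique hi0 ?_
    simpa only [hs, Function.comp_def] using hv.comp hφ.tendsto_atTop
  exact h.trans_le (csInf_le hbdd ⟨i, rfl⟩)

/-- Theorem 4.6 (iii): if the family of channels `𝒬` is (sequentially) compact under
total variation at input `P` and assumption A2 (c nonnegative, measurable, bounded)
holds, then there exist both a best and a worst channel in `𝒬`, attaining
`inf_{Q ∈ 𝒬} J(P,Q)` and `sup_{Q ∈ 𝒬} J(P,Q)` respectively. -/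
theorem stmt12 (n m k : ℕ) {ι : Type*} [Nonempty ι]
    (U : Set (Fin k → ℝ))
    (c : (Fin n → ℝ) → (Fin k → ℝ) → ℝ)
    (hc_nonneg : ∀ x u, 0 ≤ c x u)
    (hc_meas : Measurable fun p : (Fin n → ℝ) × (Fin k → ℝ) => c p.1 p.2)
    (hc_bdd : ∃ C : ℝ, ∀ x u, c x u ≤ C)
    (P : Measure (Fin n → ℝ)) [IsProbabilityMeasure P]
    (Q : ι → Kernel (Fin n → ℝ) (Fin m → ℝ)) [∀ i, IsMarkovKernel (Q i)]
    (hseqcpt : ∀ s : ℕ → ι, ∃ φ : ℕ → ℕ, StrictMono φ ∧ ∃ i0 : ι,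
      Tendsto (fun j => tvDist (P ⊗ₘ Q (s (φ j))) (P ⊗ₘ Q i0)) atTop (𝓝 0)) :
    (∃ ibest : ι, ∀ i : ι, optCost P U c (Q ibest) ≤ optCost P U c (Q i)) ∧
      (∃ iworst : ι, ∀ i : ι, optCost P U c (Q i) ≤ optCost P U c (Q iworst)) := by
  obtain ⟨C, hC⟩ := hc_bdd
  rcases U.eq_empty_or_nonempty with hU | hU
  · simp [optCost_of_isEmpty hU]
  have hJ : ∀ s : ℕ → ι, ∃ φ : ℕ → ℕ, StrictMono φ ∧ ∃ i0 : ι,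
      Tendsto (fun j => optCost P U c (Q (s (φ j)))) atTop (𝓝 (optCost P U c (Q i0))) := by
    intro s
    obtain ⟨φ, hφ, i0, hlim⟩ := hseqcpt s
    refine ⟨φ, hφ, i0, tendsto_iff_dist_tendsto_zero.2 ?_⟩
    refine squeeze_zero (fun _ => dist_nonneg)
      (fun j => abs_optCost_sub_le_mul_tvDist hc_nonneg hc_meas hC _ _ hU) ?_
    simpa using (hlim.div_const 2).const_mul C
  constructor
  · refine exists_forall_le_of_subseq_tendsto ⟨0, ?_⟩ hJ
    rintro _ ⟨i, rfl⟩
    exact optCost_nonneg hc_nonneg _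
  · have hbdd : BddBelow (Set.range fun i => -optCost P U c (Q i)) := by
      refine ⟨-C, ?_⟩
      rintro _ ⟨i, rfl⟩
      exact neg_le_neg (optCost_le hc_nonneg hC _ hU)
    obtain ⟨i0, h⟩ := exists_forall_le_of_subseq_tendsto hbdd fun s => by
      obtain ⟨φ, hφ, i0, hlim⟩ := hJ s
      exact ⟨φ, hφ, i0, hlim.neg⟩
    exact ⟨i0, fun i => neg_le_neg_iff.1 (h i)⟩
end

section
/- For any M ∈ ℕ and any probability measure P on 𝕏 = ℝ^n, the set 𝒬_D(M) of M-cell quantizers is setwise precompact at input P: every sequence in 𝒬_D(M) has a subsequence {Q_{n_k}} and a Markov kernel Q from 𝕏 to {1,…,M} such that PQ_{n_k} converges setwise to PQ. -/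
open MeasureTheory ProbabilityTheory Filter Topology

/-- An `M`-cell quantizer, viewed as a channel from `ℝ^n` to `{1,…,M}`: a kernel `Q`
such that `Q(i|x) = 1_{B_i}(x)` for a Borel measurable partition `B_1,…,B_M` of `ℝ^n`
(some cells may be empty). -/
def IsQuantizer {n M : ℕ} (Q : Kernel (Fin n → ℝ) (Fin M)) : Prop :=
  ∃ B : Fin M → Set (Fin n → ℝ),
    (∀ i, MeasurableSet (B i)) ∧
    Pairwise (Function.onFun Disjoint B) ∧
    (⋃ i, B i) = Set.univ ∧
    ∀ x i, Q x {i} = (B i).indicator (fun _ => (1 : ENNReal)) x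

/-- Measures dominated by a fixed finite measure on a countably generated space are sequentially
precompact for setwise convergence. -/
theorem exists_subseq_tendsto_setwise_of_le {X : Type*} [MeasurableSpace X]
    [MeasurableSpace.CountablyGenerated X] {ν : Measure X} [IsFiniteMeasure ν]
    {μ : ℕ → Measure X} (h_le : ∀ j, μ j ≤ ν) :
    ∃ φ : ℕ → ℕ, StrictMono φ ∧ ∃ ρ : Measure X,
      ∀ A, MeasurableSet A → Tendsto (fun j => μ (φ j) A) atTop (𝓝 (ρ A)) := by
  have : ∀ j, IsFiniteMeasure (μ j) := fun j => isFiniteMeasure_of_le ν (h_le j)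
  have h_ac : ∀ j, μ j ≪ ν := fun j => (h_le j).absolutelyContinuous
  have h_bound : ∀ j, ∀ᵐ x ∂ν, ‖((μ j).rnDeriv ν x).toReal‖ ≤ 1 := fun j => by
    filter_upwards [Measure.rnDeriv_le_one_of_le (h_le j)] with x hx
    rw [Real.norm_of_nonneg ENNReal.toReal_nonneg]
    exact ENNReal.toReal_le_of_le_ofReal zero_le_one (by simpa using hx)
  have h_mem : ∀ j, MemLp (fun x => ((μ j).rnDeriv ν x).toReal) 2 ν := fun j =>
    MemLp.of_bound (Measure.measurable_rnDeriv _ _).ennreal_toReal.aestronglyMeasurable 1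
      (h_bound j)
  let f : ℕ → Lp ℝ 2 ν := fun j => (h_mem j).toLp _
  obtain ⟨C, hC⟩ : ∃ C : ℝ, ∀ j, ‖f j‖ ≤ C := by
    refine ⟨_, fun j => Lp.norm_le_of_ae_bound zero_le_one ?_⟩
    filter_upwards [(h_mem j).coeFn_toLp, h_bound j] with x hx hb
    rwa [hx]
  have : Fact ((2 : ENNReal) ≠ ⊤) := ⟨by simp⟩
  obtain ⟨T, -, φ, hφ, hT⟩ := WeakDual.isSeqCompact_closedBall ℝ (Lp ℝ 2 ν) 0 C
    (x := fun j => StrongDual.toWeakDual (InnerProductSpace.toDual ℝ _ (f j)))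
    (fun j => by simpa using hC j)
  let g : Lp ℝ 2 ν := (InnerProductSpace.toDual ℝ _).symm (WeakDual.toStrongDual T)
  have h_int : Integrable g ν := (Lp.memLp g).integrable one_le_two
  have h_set : ∀ A, MeasurableSet A →
      Tendsto (fun j => (μ (φ j)).real A) atTop (𝓝 (∫ x in A, g x ∂ν)) := fun A hA => by
    have h := (WeakDual.eval_continuous (𝕜 := ℝ)
      (indicatorConstLp 2 hA (measure_ne_top ν A) (1 : ℝ))).tendsto T |>.comp hT
    have hg : T (indicatorConstLp 2 hA (measure_ne_top ν A) (1 : ℝ)) = ∫ x in A, g x ∂ν := by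
      rw [← L2.inner_indicatorConstLp_one (𝕜 := ℝ) hA (measure_ne_top ν A), real_inner_comm]
      simp [g]
    rw [← hg]
    refine h.congr fun j => ?_
    change inner ℝ (f (φ j)) _ = _
    rw [real_inner_comm, L2.inner_indicatorConstLp_one,
      ← Measure.setIntegral_toReal_rnDeriv (h_ac _)]
    exact integral_congr_ae (ae_restrict_of_ae (h_mem _).coeFn_toLp)
  have h_nonneg : 0 ≤ᵐ[ν] g :=
    ae_nonneg_of_forall_setIntegral_nonneg h_int fun A hA _ =>
      ge_of_tendsto' (h_set A hA) fun _ => measureReal_nonneg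
  refine ⟨φ, hφ, ν.withDensity fun x => ENNReal.ofReal (g x), fun A hA => ?_⟩
  rw [withDensity_apply _ hA, ← ofReal_integral_eq_lintegral_ofReal h_int.integrableOn
    (ae_restrict_of_ae h_nonneg)]
  exact (ENNReal.tendsto_ofReal (h_set A hA)).congr fun j => ofReal_measureReal

/-- Markov kernels into a finite discrete space are sequentially precompact for setwise convergence
of the joint measures with a fixed finite input measure. -/
theorem exists_subseq_tendsto_compProd {X Y : Type*} [MeasurableSpace X]
    [MeasurableSpace.CountablyGenerated X] [MeasurableSpace Y] [Finite Y]
    [DiscreteMeasurableSpace Y] [Nonempty Y]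
    (P : Measure X) [IsFiniteMeasure P] (K : ℕ → Kernel X Y) [∀ j, IsMarkovKernel (K j)] :
    ∃ φ : ℕ → ℕ, StrictMono φ ∧ ∃ Q : Kernel X Y, IsMarkovKernel Q ∧
      ∀ A, MeasurableSet A → Tendsto (fun j => (P ⊗ₘ K (φ j)) A) atTop (𝓝 ((P ⊗ₘ Q) A)) := by
  have h_le : ∀ j, P ⊗ₘ K j ≤ P.prod Measure.count := fun j => by
    refine Measure.le_iff.2 fun A hA => ?_
    rw [Measure.compProd_apply hA, Measure.prod_apply hA]
    refine lintegral_mono fun x => ?_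
    rcases (Prod.mk x ⁻¹' A).eq_empty_or_nonempty with h | ⟨y, hy⟩
    · simp [h]
    · calc K j x (Prod.mk x ⁻¹' A) ≤ 1 := prob_le_one
        _ = Measure.count {y} := (Measure.count_singleton y).symm
        _ ≤ Measure.count (Prod.mk x ⁻¹' A) := measure_mono (Set.singleton_subset_iff.2 hy)
  obtain ⟨φ, hφ, ρ, hρ⟩ := exists_subseq_tendsto_setwise_of_le h_le
  have h_fst : ρ.fst = P := by
    ext B hB
    rw [Measure.fst_apply hB]
    refine tendsto_nhds_unique (hρ _ (measurable_fst hB)) ?_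
    simp_rw [← Measure.fst_apply hB, Measure.fst_compProd]
    exact tendsto_const_nhds
  have : IsFiniteMeasure ρ := ⟨by
    rw [← Measure.fst_univ, h_fst]
    exact measure_lt_top P Set.univ⟩
  refine ⟨φ, hφ, ρ.condKernel, inferInstance, fun A hA => ?_⟩
  have h := ρ.disintegrate ρ.condKernel
  rw [h_fst] at h
  rw [h]
  exact hρ A hA

/-- Lemma 5.2: the set `𝒬_D(M)` of `M`-cell quantizers is setwise precompact at any
input `P`: every sequence of quantizers has a subsequence whose joint measures with `P`
converge setwise to `PQ` for some Markov kernel (channel) `Q` from `ℝ^n` to `{1,…,M}`. -/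
theorem stmt13 (n M : ℕ) (P : Measure (Fin n → ℝ)) [IsProbabilityMeasure P]
    (Qs : ℕ → Kernel (Fin n → ℝ) (Fin M)) [∀ j, IsMarkovKernel (Qs j)]
    (hq : ∀ j, IsQuantizer (Qs j)) :
    ∃ φ : ℕ → ℕ, StrictMono φ ∧
      ∃ Q : Kernel (Fin n → ℝ) (Fin M), IsMarkovKernel Q ∧
        ∀ A : Set ((Fin n → ℝ) × Fin M), MeasurableSet A →
          Tendsto (fun i => (P ⊗ₘ Qs (φ i)) A) atTop (𝓝 ((P ⊗ₘ Q) A)) := by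
  have : Nonempty (Fin M) := Measure.nonempty_of_neZero (Qs 0 0)
  exact exists_subseq_tendsto_compProd P Qs
end

section
/- Suppose the cost function c : 𝕏 × 𝕌 → ℝ is nonnegative, Borel measurable, and bounded, and let P be a probability measure on 𝕏 = ℝ^n. For any Markov kernel Q from 𝕏 to {1,…,M} there exists a deterministic M-cell quantizer Q' ∈ 𝒬_D(M) with J(P,Q') ≤ J(P,Q). Consequently, if an optimal channel exists in 𝒬(M) for the problem inf_{Q ∈ 𝒬(M)} J(P,Q), then there is a quantizer in 𝒬_D(M) that is optimal. -/
open MeasureTheory ProbabilityTheory Filter Topology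

/-- The optimal cost `J(P,Q) = inf_γ Σ_i ∫ c(x,γ(i)) Q(i|x) P(dx)` for a channel with
finite output alphabet `{1,…,M}`, the infimum over all maps `γ : {1,…,M} → 𝕌`. -/
noncomputable def optCostFin {n k M : ℕ} (P : Measure (Fin n → ℝ)) (U : Set (Fin k → ℝ))
    (c : (Fin n → ℝ) → (Fin k → ℝ) → ℝ) (Q : Kernel (Fin n → ℝ) (Fin M)) : ℝ :=
  sInf {r : ℝ | ∃ γ : Fin M → (Fin k → ℝ), (∀ i, γ i ∈ U) ∧
    r = ∑ i, ∫ x, c x (γ i) * (Q x {i}).toReal ∂P}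

/-- The cost of a channel `Q` followed by the decision map `γ`. -/
noncomputable def channelCost {n k M : ℕ} (P : Measure (Fin n → ℝ))
    (c : (Fin n → ℝ) → (Fin k → ℝ) → ℝ) (Q : Kernel (Fin n → ℝ) (Fin M))
    (γ : Fin M → (Fin k → ℝ)) : ℝ :=
  ∑ i, ∫ x, c x (γ i) * (Q x {i}).toReal ∂P

theorem isQuantizer_deterministic {n M : ℕ} {f : (Fin n → ℝ) → Fin M} (hf : Measurable f) :
    IsQuantizer (Kernel.deterministic f hf) := by
  refine ⟨fun i => f ⁻¹' {i}, fun i => hf (measurableSet_singleton i), ?_, ?_, ?_⟩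
  · intro i j hij
    exact Disjoint.preimage f (Set.disjoint_singleton.2 hij)
  · ext x
    simp
  · intro x i
    rw [Kernel.deterministic_apply' hf x (measurableSet_singleton i)]
    rfl

section Cost

variable {n k M : ℕ} {U : Set (Fin k → ℝ)} {c : (Fin n → ℝ) → (Fin k → ℝ) → ℝ}
  {P : Measure (Fin n → ℝ)}

theorem channelCost_nonneg (hc_nonneg : ∀ x u, 0 ≤ c x u) (Q : Kernel (Fin n → ℝ) (Fin M))
    (γ : Fin M → (Fin k → ℝ)) : 0 ≤ channelCost P c Q γ :=
  Finset.sum_nonneg fun _ _ => integral_nonneg fun _ =>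
    mul_nonneg (hc_nonneg _ _) ENNReal.toReal_nonneg

theorem optCostFin_le_channelCost (hc_nonneg : ∀ x u, 0 ≤ c x u)
    (Q : Kernel (Fin n → ℝ) (Fin M)) {γ : Fin M → (Fin k → ℝ)} (hγ : ∀ i, γ i ∈ U) :
    optCostFin P U c Q ≤ channelCost P c Q γ := by
  refine csInf_le ⟨0, ?_⟩ ⟨γ, hγ, rfl⟩
  rintro r ⟨γ, -, rfl⟩
  exact channelCost_nonneg hc_nonneg Q γ

theorem exists_seq_channelCost_tendsto (hc_nonneg : ∀ x u, 0 ≤ c x u)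
    (Q : Kernel (Fin n → ℝ) (Fin M)) (hU : U.Nonempty) :
    ∃ γ : ℕ → Fin M → (Fin k → ℝ), (∀ m i, γ m i ∈ U) ∧
      Tendsto (fun m => channelCost P c Q (γ m)) atTop (𝓝 (optCostFin P U c Q)) := by
  obtain ⟨u, hu⟩ := hU
  have hne : {r : ℝ | ∃ γ : Fin M → (Fin k → ℝ), (∀ i, γ i ∈ U) ∧
      r = channelCost P c Q γ}.Nonempty := ⟨_, fun _ => u, fun _ => hu, rfl⟩
  have hbdd : BddBelow {r : ℝ | ∃ γ : Fin M → (Fin k → ℝ), (∀ i, γ i ∈ U) ∧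
      r = channelCost P c Q γ} := by
    refine ⟨0, ?_⟩
    rintro r ⟨γ, -, rfl⟩
    exact channelCost_nonneg hc_nonneg Q γ
  obtain ⟨r, -, hr, hmem⟩ := exists_seq_tendsto_sInf hne hbdd
  choose γ hγ hrγ using hmem
  exact ⟨γ, hγ, (funext hrγ : r = fun m => channelCost P c Q (γ m)) ▸ hr⟩

theorem channelCost_eq_integral (hc_nonneg : ∀ x u, 0 ≤ c x u)
    (hc_meas : Measurable fun p : (Fin n → ℝ) × (Fin k → ℝ) => c p.1 p.2)
    {C : ℝ} (hC : ∀ x u, c x u ≤ C) [IsProbabilityMeasure P]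
    (Q : Kernel (Fin n → ℝ) (Fin M)) [IsMarkovKernel Q] (γ : Fin M → (Fin k → ℝ)) :
    channelCost P c Q γ = ∫ x, ∫ i, c x (γ i) ∂Q x ∂P := by
  unfold channelCost
  rw [← integral_finsetSum]
  · refine integral_congr_ae (ae_of_all _ fun x => ?_)
    simp only [integral_fintype (Integrable.of_finite (μ := Q x) (f := fun i => c x (γ i))),
      smul_eq_mul, Measure.real, mul_comm]
  · intro i _
    refine Integrable.of_bound (C := C) ?_ (ae_of_all _ fun x => ?_)
    · exact ((hc_meas.comp (measurable_id.prodMk measurable_const)).mul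
        (Q.measurable_coe (measurableSet_singleton i)).ennreal_toReal).aestronglyMeasurable
    · rw [Real.norm_of_nonneg (mul_nonneg (hc_nonneg _ _) ENNReal.toReal_nonneg)]
      calc c x (γ i) * (Q x {i}).toReal ≤ c x (γ i) * 1 :=
            mul_le_mul_of_nonneg_left
              (ENNReal.toReal_le_of_le_ofReal zero_le_one (by simpa using prob_le_one))
              (hc_nonneg _ _)
        _ ≤ C := by simpa using hC x (γ i)

theorem exists_quantizer_optCostFin_le (hc_nonneg : ∀ x u, 0 ≤ c x u)
    (hc_meas : Measurable fun p : (Fin n → ℝ) × (Fin k → ℝ) => c p.1 p.2)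
    {C : ℝ} (hC : ∀ x u, c x u ≤ C) [IsProbabilityMeasure P]
    (Q : Kernel (Fin n → ℝ) (Fin M)) [IsMarkovKernel Q] :
    ∃ f : (Fin n → ℝ) → Fin M, ∃ hf : Measurable f,
      optCostFin P U c (Kernel.deterministic f hf) ≤ optCostFin P U c Q := by
  have : Nonempty (Fin M) := (Q 0).nonempty_of_neZero
  rcases U.eq_empty_or_nonempty with rfl | hU
  · exact ⟨fun _ => Classical.arbitrary _, measurable_const, by simp [optCostFin]⟩
  obtain ⟨f, hf, hfQ⟩ := Kernel.exists_measurable_map_eq_unitInterval Q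
  obtain ⟨γ, hγU, hγ⟩ := exists_seq_channelCost_tendsto (P := P) hc_nonneg Q hU
  have hfω (ω : unitInterval) : Measurable fun x => f x ω :=
    hf.comp (measurable_id.prodMk measurable_const)
  have hγf (m : ℕ) : Measurable fun p : (Fin n → ℝ) × unitInterval =>
      c p.1 (γ m (f p.1 p.2)) :=
    hc_meas.comp (measurable_fst.prodMk ((measurable_of_finite (γ m)).comp hf))
  set h : ℕ → unitInterval → ℝ := fun m ω => ∫ x, c x (γ m (f x ω)) ∂P with h_def
  have hcost (m : ℕ) (ω : unitInterval) :
      channelCost P c (Kernel.deterministic _ (hfω ω)) (γ m) = h m ω := by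
    rw [channelCost_eq_integral hc_nonneg hc_meas hC]
    simp [h_def, Kernel.deterministic_apply]
  have h_nonneg (m : ℕ) (ω : unitInterval) : 0 ≤ h m ω :=
    integral_nonneg fun _ => hc_nonneg _ _
  have h_le (m : ℕ) (ω : unitInterval) : h m ω ≤ C := by
    have hle := integral_mono_of_nonneg (μ := P)
      (ae_of_all _ fun x => hc_nonneg x (γ m (f x ω))) (integrable_const C)
      (ae_of_all _ fun x => hC x (γ m (f x ω)))
    simpa using hle
  have h_meas (m : ℕ) : Measurable (h m) :=
    (hγf m).stronglyMeasurable.integral_prod_left'.measurable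
  have h_bdd (ω : unitInterval) : BddBelow (Set.range fun m => h m ω) :=
    ⟨0, by rintro _ ⟨m, rfl⟩; exact h_nonneg m ω⟩
  have h_int (m : ℕ) : Integrable (h m) :=
    Integrable.of_bound (h_meas m).aestronglyMeasurable C
      (ae_of_all _ fun ω => by rw [Real.norm_of_nonneg (h_nonneg m ω)]; exact h_le m ω)
  have hQ (m : ℕ) : ∫ ω, h m ω = channelCost P c Q (γ m) := by
    rw [channelCost_eq_integral hc_nonneg hc_meas hC, h_def, integral_integral_swap]
    · refine integral_congr_ae (ae_of_all _ fun x => ?_)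
      have hfx : Measurable (f x) := hf.comp (measurable_const.prodMk measurable_id)
      beta_reduce
      rw [← hfQ x, integral_map hfx.aemeasurable (measurable_of_finite _).aestronglyMeasurable]
    · exact Integrable.of_bound ((hγf m).comp measurable_swap).aestronglyMeasurable C
        (ae_of_all _ fun p => by
          simpa [Function.uncurry, abs_of_nonneg (hc_nonneg _ _)] using hC _ _)
  have g_int : Integrable fun ω => ⨅ m, h m ω :=
    (h_int 0).mono' (Measurable.iInf h_meas).aestronglyMeasurable
      (ae_of_all _ fun ω => by
        rw [Real.norm_of_nonneg (le_ciInf fun m => h_nonneg m ω)]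
        exact ciInf_le (h_bdd ω) 0)
  obtain ⟨ω, hω⟩ := exists_le_integral g_int
  refine ⟨fun x => f x ω, hfω ω, ?_⟩
  calc optCostFin P U c (Kernel.deterministic _ (hfω ω))
      ≤ ⨅ m, h m ω := le_ciInf fun m =>
        (optCostFin_le_channelCost hc_nonneg _ (hγU m)).trans_eq (hcost m ω)
    _ ≤ ∫ ω, ⨅ m, h m ω := hω
    _ ≤ optCostFin P U c Q := ge_of_tendsto' hγ fun m => (hQ m).symm ▸
        integral_mono g_int (h_int m) fun ω => ciInf_le (h_bdd ω) m

end Cost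

/-- Proposition 5.5: under assumption A2 (c nonnegative, measurable, bounded), for any
Markov kernel `Q` from `ℝ^n` to `{1,…,M}` there is a deterministic quantizer `Q'` with
`J(P,Q') ≤ J(P,Q)`. Consequently, if an optimal channel exists in `𝒬(M)`, then some
deterministic quantizer in `𝒬_D(M)` is optimal. -/
theorem stmt15 (n k M : ℕ) (U : Set (Fin k → ℝ))
    (c : (Fin n → ℝ) → (Fin k → ℝ) → ℝ)
    (hc_nonneg : ∀ x u, 0 ≤ c x u)
    (hc_meas : Measurable fun p : (Fin n → ℝ) × (Fin k → ℝ) => c p.1 p.2)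
    (hc_bdd : ∃ C : ℝ, ∀ x u, c x u ≤ C)
    (P : Measure (Fin n → ℝ)) [IsProbabilityMeasure P] :
    (∀ Q : Kernel (Fin n → ℝ) (Fin M), IsMarkovKernel Q →
      ∃ Q' : Kernel (Fin n → ℝ) (Fin M), IsQuantizer Q' ∧
        optCostFin P U c Q' ≤ optCostFin P U c Q) ∧
    ((∃ Qopt : Kernel (Fin n → ℝ) (Fin M), IsMarkovKernel Qopt ∧
        ∀ Q : Kernel (Fin n → ℝ) (Fin M), IsMarkovKernel Q →
          optCostFin P U c Qopt ≤ optCostFin P U c Q) →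
      ∃ Q' : Kernel (Fin n → ℝ) (Fin M), IsQuantizer Q' ∧
        ∀ Q : Kernel (Fin n → ℝ) (Fin M), IsMarkovKernel Q →
          optCostFin P U c Q' ≤ optCostFin P U c Q) := by
  obtain ⟨C, hC⟩ := hc_bdd
  have key (Q : Kernel (Fin n → ℝ) (Fin M)) (_ : IsMarkovKernel Q) :
      ∃ Q' : Kernel (Fin n → ℝ) (Fin M), IsQuantizer Q' ∧
        optCostFin P U c Q' ≤ optCostFin P U c Q := by
    obtain ⟨f, hf, hle⟩ :=
      exists_quantizer_optCostFin_le (U := U) (P := P) hc_nonneg hc_meas hC Q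
    exact ⟨_, isQuantizer_deterministic hf, hle⟩
  refine ⟨key, ?_⟩
  rintro ⟨Qopt, hQopt, hopt⟩
  obtain ⟨Q', hQ', hle⟩ := key Qopt hQopt
  exact ⟨Q', hQ', fun Q hQ => hle.trans (hopt Q hQ)⟩
end
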